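/- For all integers 0 ≤ l ≤ n and 0 ≤ k ≤ m with (n, l) ≠ (m, k), the Appell polynomials are orthogonal over the unit ball: ∫_{B⁺} conj(A_n^l(x))·A_m^k(x) dx = 0, where the integral is the quaternion-valued Lebesgue integral over B⁺. -/

import Mathlib

open MeasureTheory Metric Finset

noncomputable section

/-- `ℝ³` with the Euclidean norm and Lebesgue measure. -/
abbrev R3 := EuclideanSpace ℝ (Fin 3)
/-- the real quaternions ℍ -/
abbrev QH := Quaternion ℝ

/-- the basis quaternion e₁ -/
def e1 : QH := ⟨0,1,0,0⟩
/-- the basis quaternion e₂ -/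
def e2 : QH := ⟨0,0,1,0⟩
/-- the basis quaternion e₃ -/
def e3 : QH := ⟨0,0,0,1⟩

/-- embed a point of ℝ³ as the reduced quaternion x₀ + x₁e₁ + x₂e₂ -/
def toQ (x : R3) : QH := ⟨x 0, x 1, x 2, 0⟩
/-- the conjugate reduced quaternion x₀ - x₁e₁ - x₂e₂ -/
def toQbar (x : R3) : QH := ⟨x 0, -(x 1), -(x 2), 0⟩
/-- ζ = x₁ - x₂e₃ -/
def zeta (x : R3) : QH := ⟨x 1, 0, 0, -(x 2)⟩

/-- build a point of ℝ³ from coordinates -/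
def mk3 (a b c : ℝ) : R3 := (WithLp.equiv 2 (Fin 3 → ℝ)).symm ![a, b, c]

/-- the conjugated point (x₀, -x₁, -x₂) -/
def barPt (x : R3) : R3 := mk3 (x 0) (-(x 1)) (-(x 2))

/-- partial derivative ∂f/∂xᵢ -/
def pd (i : Fin 3) (f : R3 → QH) (x : R3) : QH :=
  fderiv ℝ f x (EuclideanSpace.single i 1)

/-- the generalized Cauchy-Riemann operator ∂̄f = ∂f/∂x₀ + e₁∂f/∂x₁ + e₂∂f/∂x₂ -/
def CRbar (f : R3 → QH) (x : R3) : QH :=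
  pd 0 f x + e1 * pd 1 f x + e2 * pd 2 f x

/-- the adjoint generalized Cauchy-Riemann operator ∂f = ∂f/∂x₀ - e₁∂f/∂x₁ - e₂∂f/∂x₂ -/
def Dadj (f : R3 → QH) (x : R3) : QH :=
  pd 0 f x - e1 * pd 1 f x - e2 * pd 2 f x

/-- the hypercomplex derivative ∂₀ = (1/2)∂ -/
def D0 (f : R3 → QH) : R3 → QH := fun x =>
  (1/2 : ℝ) • (pd 0 f x - e1 * pd 1 f x - e2 * pd 2 f x)

/-- the operator ∂̄_ℂ f = (1/2)(∂f/∂x₁ + e₃∂f/∂x₂) -/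
def DbarC (f : R3 → QH) : R3 → QH := fun x =>
  (1/2 : ℝ) • (pd 1 f x + e3 * pd 2 f x)

/-- the involution f⁰ + f¹e₁ + f²e₂ + f³e₃ ↦ f⁰ - f¹e₁ - f²e₂ + f³e₃ -/
def invol (a : QH) : QH := ⟨a.re, -a.imI, -a.imJ, a.imK⟩

/-- the inner Appell polynomial A_n^l -/
def appell (n l : ℕ) (x : R3) : QH :=
  ((n.factorial * l.factorial : ℝ) /
      (2 ^ (2 * (n - l)) * (n + l + 1).factorial * (2 * l).factorial)) •
    ((∑ h ∈ Finset.range (n - l + 1),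
        (((2 * n - 2 * h + 1).factorial * (2 * l + 2 * h).factorial : ℝ) /
            (h.factorial * (n - l - h).factorial * (n - h).factorial * (l + h).factorial)) •
          (toQbar x ^ h * toQ x ^ (n - l - h))) * zeta x ^ l)

/-- the Kelvin transform K(P)(x) = (x̄/|x|³)·P(x̄/|x|²) -/
def kelvin (P : R3 → QH) (x : R3) : QH :=
  ((‖x‖ ^ 3)⁻¹ • toQbar x) * P ((‖x‖ ^ 2)⁻¹ • barPt x)

/-- the outer Appell function A_{-(n+2)}^l -/
def outerAppell (n l : ℕ) (x : R3) : QH :=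
  (((n + l + 1).factorial * (n - l).factorial : ℝ) / (n.factorial * (n + 1).factorial)) •
    kelvin (appell n l) x

/-- surface integral over the sphere of radius ρ (parametrized by the unit sphere
with its surface measure, with the Jacobian factor ρ²) -/
def sphereIntegral (ρ : ℝ) (g : R3 → QH) : QH :=
  ∫ ω : sphere (0 : R3) 1, (ρ ^ 2) • g (ρ • (ω : R3)) ∂((volume : Measure R3).toSphere)

/-- the unified family ψ_k^l, k ∈ ℤ \ {-1}: inner Appell polynomials for k ≥ 0,
outer Appell functions for k ≤ -2 -/
def psiFam (k : ℤ) (l : ℕ) (x : R3) : QH :=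
  if 0 ≤ k then appell k.toNat l x else outerAppell (-k - 2).toNat l x

/-- The `i`-th partial derivative of a polynomial function is the line derivative along the
`i`-th coordinate axis. -/
lemma hasLineDerivAt_eval (p : MvPolynomial (Fin 3) ℝ) (i : Fin 3) (x : R3) :
    HasLineDerivAt ℝ (fun y : R3 => MvPolynomial.eval y p)
      (MvPolynomial.eval x (MvPolynomial.pderiv i p)) x (EuclideanSpace.single i 1) := by
  unfold HasLineDerivAt
  induction p using MvPolynomial.induction_on with
  | C a => simpa using hasDerivAt_const (0 : ℝ) a
  | add p q hp hq =>
    simp only [map_add]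
    exact hp.fun_add hq
  | mul_X p j hp =>
    have hX : HasDerivAt (fun t : ℝ => x j + t * (EuclideanSpace.single i (1 : ℝ) : R3) j)
        ((EuclideanSpace.single i (1 : ℝ) : R3) j) 0 := by
      simpa only [id, one_mul] using ((hasDerivAt_id (0 : ℝ)).mul_const _).const_add (x j)
    simp only [map_mul, MvPolynomial.eval_X]
    refine (hp.fun_mul hX).congr_deriv ?_
    rcases eq_or_ne i j with rfl | h
    · simp
      ring
    · simp [MvPolynomial.pderiv_X, h.symm]
      ring

lemma contDiff_eval (p : MvPolynomial (Fin 3) ℝ) :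
    ContDiff ℝ ⊤ (fun y : R3 => MvPolynomial.eval y p) := by
  induction p using MvPolynomial.induction_on with
  | C a => simpa using contDiff_const
  | add p q hp hq => simpa using hp.add hq
  | mul_X p j hp =>
    have hX : ContDiff ℝ ⊤ (fun y : R3 => y j) := by fun_prop
    simpa using hp.mul hX

/-- The squared norm `x₀² + x₁² + x₂²` as a polynomial. -/
def normSqPoly : MvPolynomial (Fin 3) ℝ :=
  MvPolynomial.X 0 ^ 2 + MvPolynomial.X 1 ^ 2 + MvPolynomial.X 2 ^ 2

lemma eval_normSqPoly (x : R3) : MvPolynomial.eval x normSqPoly = ‖x‖ ^ 2 := by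
  simp [normSqPoly, EuclideanSpace.norm_sq_eq, Fin.sum_univ_three]

/-- The Lipschitz cutoff `(1 - ‖x‖²)₊` of the unit ball. -/
def ballCutoff (x : R3) : ℝ := max (1 - ‖x‖ ^ 2) 0

lemma lipschitzWith_ballCutoff : LipschitzWith 2 ballCutoff := by
  refine LipschitzWith.of_le_add_mul 2 fun x y => ?_
  have hx := norm_nonneg x
  have hy := norm_nonneg y
  have hd : ‖y‖ ≤ ‖x‖ + dist x y := by
    rw [dist_comm, dist_eq_norm]
    linarith [norm_sub_norm_le y x]
  have hd0 : 0 ≤ dist x y := dist_nonneg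
  unfold ballCutoff
  push_cast
  refine max_le ?_ (by positivity)
  rcases le_total ‖y‖ 1 with h | h
  · refine le_trans ?_ (add_le_add_left (le_max_left _ _) _)
    rcases le_total ‖x‖ 1 with h' | h' <;> nlinarith
  · refine le_trans ?_ (add_le_add_left (le_max_right _ _) _)
    rcases le_total ‖x‖ 1 with h' | h' <;> nlinarith

lemma ballCutoff_eq_zero {x : R3} (hx : x ∉ ball (0 : R3) 1) : ballCutoff x = 0 := by
  have : 1 ≤ ‖x‖ := by simpa using hx
  exact max_eq_right (by nlinarith)

lemma ballCutoff_of_mem {x : R3} (hx : x ∈ ball (0 : R3) 1) :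
    ballCutoff x = MvPolynomial.eval x (1 - normSqPoly) := by
  have h1 : ‖x‖ < 1 := by simpa using hx
  rw [map_sub, eval_normSqPoly, map_one]
  exact max_eq_left (by nlinarith [norm_nonneg x])

lemma hasCompactSupport_ballCutoff : HasCompactSupport ballCutoff :=
  HasCompactSupport.of_support_subset_isCompact (isCompact_closedBall (0 : R3) 1) fun x hx =>
    ball_subset_closedBall (by by_contra h; exact hx (ballCutoff_eq_zero h))

lemma integrableOn_eval (p : MvPolynomial (Fin 3) ℝ) :
    IntegrableOn (fun x : R3 => MvPolynomial.eval x p) (ball 0 1) :=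
  ((contDiff_eval p).continuous.continuousOn.integrableOn_compact
    (isCompact_closedBall (0 : R3) 1)).mono_set ball_subset_closedBall

/-- Integration of polynomials over the unit ball, as a linear functional. -/
def ballIntegral : MvPolynomial (Fin 3) ℝ →ₗ[ℝ] ℝ where
  toFun p := ∫ x in ball (0 : R3) 1, MvPolynomial.eval x p
  map_add' p q := by
    simp only [map_add]
    exact integral_add (integrableOn_eval p) (integrableOn_eval q)
  map_smul' c p := by
    simp [MvPolynomial.smul_eval, integral_const_mul]

lemma lineDeriv_ballCutoff {x : R3} (hx : x ∈ ball (0 : R3) 1) (i : Fin 3) :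
    lineDeriv ℝ ballCutoff x (-EuclideanSpace.single i 1) = 2 * x i := by
  have h : ballCutoff =ᶠ[nhds x] fun y => MvPolynomial.eval y (1 - normSqPoly) := by
    filter_upwards [isOpen_ball.mem_nhds hx] with y hy using ballCutoff_of_mem hy
  rw [lineDeriv_neg, h.lineDeriv_eq, (hasLineDerivAt_eval _ i x).lineDeriv]
  fin_cases i <;> simp [normSqPoly, MvPolynomial.pderiv_X]

lemma lineDeriv_ballCutoff_eq_zero {x : R3} (hx : x ∉ closedBall (0 : R3) 1) (v : R3) :
    lineDeriv ℝ ballCutoff x v = 0 := by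
  have h : ballCutoff =ᶠ[nhds x] fun _ => 0 := by
    filter_upwards [isClosed_closedBall.isOpen_compl.mem_nhds hx] with y hy
    exact ballCutoff_eq_zero fun h => hy (ball_subset_closedBall h)
  rw [h.lineDeriv_eq]
  simp [lineDeriv]

/-- The divergence theorem on the unit ball, for polynomials vanishing on the sphere. -/
lemma ballIntegral_pderiv (i : Fin 3) (p : MvPolynomial (Fin 3) ℝ) :
    ballIntegral (MvPolynomial.pderiv i ((1 - normSqPoly) * p)) = 0 := by
  let χ : ContDiffBump (0 : R3) := ⟨1, 2, one_pos, one_lt_two⟩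
  let f : R3 → ℝ := fun x => χ x * MvPolynomial.eval x p
  have hf : ContDiff ℝ 1 f := χ.contDiff.mul ((contDiff_eval p).of_le le_top)
  have hfc : HasCompactSupport f := χ.hasCompactSupport.mul_right
  obtain ⟨C, hC⟩ := hf.lipschitzWith_of_hasCompactSupport hfc one_ne_zero
  have hfp : ∀ x ∈ ball (0 : R3) 1, f x = MvPolynomial.eval x p := fun x hx => by
    simp only [f, χ.one_of_mem_closedBall (ball_subset_closedBall hx), one_mul]
  have hf' : ∀ x ∈ ball (0 : R3) 1, lineDeriv ℝ f x (EuclideanSpace.single i 1) =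
      MvPolynomial.eval x (MvPolynomial.pderiv i p) := fun x hx => by
    have h : f =ᶠ[nhds x] fun y => MvPolynomial.eval y p := by
      filter_upwards [isOpen_ball.mem_nhds hx] with y hy using hfp y hy
    rw [h.lineDeriv_eq, (hasLineDerivAt_eval _ i x).lineDeriv]
  have key := hC.integral_lineDeriv_mul_eq (μ := volume) lipschitzWith_ballCutoff
    hasCompactSupport_ballCutoff (EuclideanSpace.single i 1)
  have hL : ∫ x, lineDeriv ℝ f x (EuclideanSpace.single i 1) * ballCutoff x =
      ballIntegral (MvPolynomial.pderiv i p * (1 - normSqPoly)) := by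
    rw [← setIntegral_eq_integral_of_forall_compl_eq_zero (s := ball (0 : R3) 1)
      fun x hx => by rw [ballCutoff_eq_zero hx, mul_zero]]
    refine setIntegral_congr_fun measurableSet_ball fun x hx => ?_
    simp only [hf' x hx, ballCutoff_of_mem hx, map_mul]
  have hR : ∫ x, lineDeriv ℝ ballCutoff x (-EuclideanSpace.single i 1) * f x =
      ballIntegral (2 * MvPolynomial.X i * p) := by
    rw [← setIntegral_eq_integral_of_forall_compl_eq_zero (s := closedBall (0 : R3) 1)
      fun x hx => by rw [lineDeriv_ballCutoff_eq_zero hx, zero_mul]]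
    have hae : (ball (0 : R3) 1) =ᵐ[volume] closedBall (0 : R3) 1 := by
      refine Filter.EventuallyLE.antisymm (ball_subset_closedBall.eventuallyLE) ?_
      rw [ae_le_set, closedBall_sdiff_ball]
      exact Measure.addHaar_sphere volume 0 1
    rw [← setIntegral_congr_set hae]
    refine setIntegral_congr_fun measurableSet_ball fun x hx => ?_
    simp only [hfp x hx, lineDeriv_ballCutoff hx, map_mul, MvPolynomial.eval_X, map_ofNat]
  rw [hL, hR, ← sub_eq_zero, ← map_sub] at key
  rw [← key]
  congr 1
  have : MvPolynomial.pderiv i (1 - normSqPoly) = - (2 * MvPolynomial.X i) := by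
    fin_cases i <;> simp [normSqPoly, MvPolynomial.pderiv_X]
  rw [Derivation.leibniz, this]
  simp only [smul_eq_mul]
  ring

section PolynomialCalculus

open MvPolynomial

/-- The quaternions over a commutative ring. -/
abbrev QuatOver (R : Type) [CommRing R] := Quaternion R

/-- Quaternion-valued polynomials in three real variables. -/
abbrev PolyQ := QuatOver (MvPolynomial (Fin 3) ℝ)

/-- The partial derivative, taken componentwise. -/
def partialD (i : Fin 3) : PolyQ →ₗ[ℝ] PolyQ where
  toFun f := ⟨pderiv i f.re, pderiv i f.imI, pderiv i f.imJ, pderiv i f.imK⟩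
  map_add' f g := by ext1 <;> exact map_add _ _ _
  map_smul' c f := by ext1 <;> exact (pderiv i).map_smul _ _

section

variable (i : Fin 3) (f g : PolyQ)

@[simp] lemma partialD_re : (partialD i f).re = pderiv i f.re := rfl
@[simp] lemma partialD_imI : (partialD i f).imI = pderiv i f.imI := rfl
@[simp] lemma partialD_imJ : (partialD i f).imJ = pderiv i f.imJ := rfl
@[simp] lemma partialD_imK : (partialD i f).imK = pderiv i f.imK := rfl

lemma partialD_mul : partialD i (f * g) = partialD i f * g + f * partialD i g := by
  ext1 <;> simp <;> ring

lemma partialD_star : partialD i (star f) = star (partialD i f) := by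
  ext1 <;> simp

lemma partialD_smul (p : MvPolynomial (Fin 3) ℝ) :
    partialD i (p • f) = pderiv i p • f + p • partialD i f := by
  ext1 <;> simp <;> ring
end

@[simp] lemma polyQ_zero_components : (0 : PolyQ).re = 0 ∧ (0 : PolyQ).imI = 0 ∧
    (0 : PolyQ).imJ = 0 ∧ (0 : PolyQ).imK = 0 := ⟨rfl, rfl, rfl, rfl⟩

@[simp] lemma polyQ_one_components : (1 : PolyQ).re = 1 ∧ (1 : PolyQ).imI = 0 ∧
    (1 : PolyQ).imJ = 0 ∧ (1 : PolyQ).imK = 0 := ⟨rfl, rfl, rfl, rfl⟩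

/-- The constant polynomial `e₁`. -/
def unit1 : PolyQ := ⟨0, 1, 0, 0⟩
/-- The constant polynomial `e₂`. -/
def unit2 : PolyQ := ⟨0, 0, 1, 0⟩
/-- The constant polynomial `e₃`. -/
def unit3 : PolyQ := ⟨0, 0, 0, 1⟩
/-- The reduced quaternion variable `x₀ + x₁e₁ + x₂e₂`. -/
def varX : PolyQ := ⟨X 0, X 1, X 2, 0⟩
/-- The variable `ζ = x₁ - x₂e₃`. -/
def varZ : PolyQ := ⟨X 1, 0, 0, -X 2⟩

@[simp] lemma unit1_components :
    unit1.re = 0 ∧ unit1.imI = 1 ∧ unit1.imJ = 0 ∧ unit1.imK = 0 := by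
  simp only [unit1, and_self]

@[simp] lemma unit2_components :
    unit2.re = 0 ∧ unit2.imI = 0 ∧ unit2.imJ = 1 ∧ unit2.imK = 0 := by
  simp only [unit2, and_self]

@[simp] lemma unit3_components :
    unit3.re = 0 ∧ unit3.imI = 0 ∧ unit3.imJ = 0 ∧ unit3.imK = 1 := by
  simp only [unit3, and_self]

@[simp] lemma varX_components :
    varX.re = X 0 ∧ varX.imI = X 1 ∧ varX.imJ = X 2 ∧ varX.imK = 0 := by
  simp only [varX, and_self]

@[simp] lemma varZ_components :
    varZ.re = X 1 ∧ varZ.imI = 0 ∧ varZ.imJ = 0 ∧ varZ.imK = -X 2 := by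
  simp only [varZ, and_self]

/-- The generalized Cauchy-Riemann operator. -/
def cauchyRiemann : PolyQ →+ PolyQ :=
  (partialD 0).toAddMonoidHom + (AddMonoidHom.mulLeft unit1).comp (partialD 1).toAddMonoidHom +
    (AddMonoidHom.mulLeft unit2).comp (partialD 2).toAddMonoidHom

/-- The Laplace operator. -/
def laplace : PolyQ →ₗ[ℝ] PolyQ :=
  partialD 0 ∘ₗ partialD 0 + partialD 1 ∘ₗ partialD 1 + partialD 2 ∘ₗ partialD 2

/-- The Euler operator. -/
def euler : PolyQ →ₗ[ℝ] PolyQ :=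
  (X 0 : MvPolynomial (Fin 3) ℝ) • partialD 0 + (X 1 : MvPolynomial (Fin 3) ℝ) • partialD 1 +
    (X 2 : MvPolynomial (Fin 3) ℝ) • partialD 2

/-- The angular derivative in the `(x₁, x₂)`-plane. -/
def angular : PolyQ →ₗ[ℝ] PolyQ :=
  (X 1 : MvPolynomial (Fin 3) ℝ) • partialD 2 - (X 2 : MvPolynomial (Fin 3) ℝ) • partialD 1

lemma pderiv_normSqPoly (i : Fin 3) : pderiv i normSqPoly = X i + X i := by
  fin_cases i <;> simp [normSqPoly, pderiv_X, two_mul]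

section

variable (f g : PolyQ)

lemma cauchyRiemann_X_smul :
    cauchyRiemann ((X 0 : MvPolynomial (Fin 3) ℝ) • f) =
      f + (X 0 : MvPolynomial (Fin 3) ℝ) • cauchyRiemann f := by
  ext1 <;> simp [cauchyRiemann, pderiv_X] <;> ring

lemma cauchyRiemann_varX_mul :
    cauchyRiemann (varX * f) =
      star varX * cauchyRiemann f + (2 : MvPolynomial (Fin 3) ℝ) • (varX * partialD 0 f) -
        (2 : MvPolynomial (Fin 3) ℝ) • euler f - f := by
  ext1 <;> simp [cauchyRiemann, euler, pderiv_X] <;> ring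

lemma cauchyRiemann_normSq_smul :
    cauchyRiemann (normSqPoly • f) =
      normSqPoly • cauchyRiemann f + (2 : MvPolynomial (Fin 3) ℝ) • (varX * f) := by
  ext1 <;> simp [cauchyRiemann, pderiv_normSqPoly] <;> ring

lemma laplace_X_smul :
    laplace ((X 0 : MvPolynomial (Fin 3) ℝ) • f) =
      (X 0 : MvPolynomial (Fin 3) ℝ) • laplace f +
        (2 : MvPolynomial (Fin 3) ℝ) • partialD 0 f := by
  ext1 <;> simp [laplace, pderiv_X] <;> ring

lemma laplace_varX_mul :
    laplace (varX * f) = varX * laplace f + (2 : MvPolynomial (Fin 3) ℝ) • cauchyRiemann f := by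
  ext1 <;> simp [laplace, cauchyRiemann, pderiv_X] <;> ring

lemma laplace_normSq_smul :
    laplace (normSqPoly • f) = normSqPoly • laplace f +
      (4 : MvPolynomial (Fin 3) ℝ) • euler f + (6 : MvPolynomial (Fin 3) ℝ) • f := by
  ext1 <;> simp [laplace, euler, pderiv_normSqPoly, pderiv_X] <;> ring

lemma euler_mul : euler (f * g) = euler f * g + f * euler g := by
  ext1 <;> simp [euler] <;> ring

lemma euler_star : euler (star f) = star (euler f) := by
  ext1 <;> simp [euler]

lemma euler_varX : euler varX = varX := by
  ext1 <;> simp [euler, pderiv_X]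

lemma euler_X_smul : euler ((X 0 : MvPolynomial (Fin 3) ℝ) • f) =
    (X 0 : MvPolynomial (Fin 3) ℝ) • (f + euler f) := by
  ext1 <;> simp [euler, pderiv_X] <;> ring

lemma euler_normSq_smul : euler (normSqPoly • f) =
    normSqPoly • ((2 : MvPolynomial (Fin 3) ℝ) • f + euler f) := by
  ext1 <;> simp [euler, normSqPoly] <;> ring

lemma angular_mul : angular (f * g) = angular f * g + f * angular g := by
  ext1 <;> simp [angular] <;> ring

lemma angular_star : angular (star f) = star (angular f) := by
  ext1 <;> simp [angular]

lemma angular_varX :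
    (2 : MvPolynomial (Fin 3) ℝ) • angular varX = unit3 * varX - varX * unit3 := by
  ext1 <;> simp [angular, pderiv_X] <;> ring

lemma angular_X_smul : angular ((X 0 : MvPolynomial (Fin 3) ℝ) • f) =
    (X 0 : MvPolynomial (Fin 3) ℝ) • angular f := by
  ext1 <;> simp [angular, pderiv_X] <;> ring

lemma angular_normSq_smul : angular (normSqPoly • f) = normSqPoly • angular f := by
  ext1 <;> simp [angular, pderiv_normSqPoly] <;> ring
end

lemma unit3_mul_varZ : unit3 * varZ = varZ * unit3 := by
  ext1 <;> simp

lemma unit3_mul_unit3_mul (f : PolyQ) : unit3 * (unit3 * f) = -f := by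
  ext1 <;> simp

lemma partialD_varZ_pow (l : ℕ) :
    partialD 0 (varZ ^ l) = 0 ∧ partialD 2 (varZ ^ l) = -(unit3 * partialD 1 (varZ ^ l)) := by
  induction l with
  | zero => constructor <;> ext1 <;> simp
  | succ l ih =>
    have h0 : partialD 0 varZ = 0 := by ext1 <;> simp [pderiv_X]
    have h1 : partialD 1 varZ = 1 := by ext1 <;> simp [pderiv_X]
    have h2 : partialD 2 varZ = -unit3 := by ext1 <;> simp [pderiv_X]
    rw [pow_succ', partialD_mul, partialD_mul, partialD_mul, ih.1, ih.2, h0, h1, h2, mul_add,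
      ← mul_assoc unit3 varZ, unit3_mul_varZ]
    constructor <;> noncomm_ring

lemma cauchyRiemann_varZ_pow (l : ℕ) : cauchyRiemann (varZ ^ l) = 0 := by
  obtain ⟨h0, h2⟩ := partialD_varZ_pow l
  simp only [cauchyRiemann, AddMonoidHom.add_apply, AddMonoidHom.comp_apply,
    LinearMap.toAddMonoidHom_coe, AddMonoidHom.coe_mulLeft, h0, h2]
  ext1 <;> simp

lemma laplace_varZ_mul (f : PolyQ) : laplace (varZ * f) =
    varZ * laplace f + (2 : MvPolynomial (Fin 3) ℝ) • (partialD 1 f - unit3 * partialD 2 f) := by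
  ext1 <;> simp [laplace, pderiv_X] <;> ring

lemma laplace_varZ_pow (l : ℕ) : laplace (varZ ^ l) = 0 := by
  induction l with
  | zero => ext1 <;> simp [laplace]
  | succ l ih =>
    rw [pow_succ', laplace_varZ_mul, ih, (partialD_varZ_pow l).2, mul_neg, unit3_mul_unit3_mul]
    simp

lemma euler_varZ_pow (l : ℕ) : euler (varZ ^ l) = l • varZ ^ l := by
  induction l with
  | zero => ext1 <;> simp [euler]
  | succ l ih =>
    have h : euler varZ = varZ := by ext1 <;> simp [euler, pderiv_X]
    rw [pow_succ', euler_mul, ih, h, mul_smul_comm, succ_nsmul']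

lemma angular_varZ_pow (l : ℕ) : angular (varZ ^ l) = -(l • (varZ ^ l * unit3)) := by
  induction l with
  | zero => ext1 <;> simp [angular]
  | succ l ih =>
    have h : angular varZ = -(varZ * unit3) := by ext1 <;> simp [angular, pderiv_X]
    have hc : unit3 * varZ ^ l = varZ ^ l * unit3 :=
      (show Commute unit3 varZ from unit3_mul_varZ).pow_right l
    rw [pow_succ', angular_mul, ih, h, mul_neg, mul_smul_comm, neg_mul, mul_assoc, hc, mul_assoc]
    module

/-- The Appell polynomials up to normalization, shifted by one (`appellAux l (N + 1)` has degree
`N + l`) and defined by their three-term recurrence. -/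
def appellAux (l : ℕ) : ℕ → PolyQ
  | 0 => 0
  | 1 => varZ ^ l
  | N + 2 => (2 * N + 2 * l + 1) • ((X 0 : MvPolynomial (Fin 3) ℝ) • appellAux l (N + 1)) +
      varX * appellAux l (N + 1) - (N * (N + 2 * l + 1)) • (normSqPoly • appellAux l N)

lemma appellAux_add_two (l N : ℕ) : appellAux l (N + 2) =
    (2 * N + 2 * l + 1) • ((X 0 : MvPolynomial (Fin 3) ℝ) • appellAux l (N + 1)) +
      varX * appellAux l (N + 1) - (N * (N + 2 * l + 1)) • (normSqPoly • appellAux l N) := rfl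

lemma partialD_appellAux (l : ℕ) :
    ∀ N, partialD 0 (appellAux l (N + 1)) = (N * (N + 2 * l + 1)) • appellAux l N
  | 0 => by simpa [appellAux] using (partialD_varZ_pow l).1
  | N + 1 => by
    have h0 : partialD 0 varX = 1 := by ext1 <;> simp [pderiv_X]
    have h1 := partialD_appellAux l N
    rw [appellAux_add_two, map_sub, map_add, map_nsmul, map_nsmul, partialD_mul, partialD_smul,
      partialD_smul, h1, h0, pderiv_normSqPoly, pderiv_X_self]
    cases N with
    | zero => simp [appellAux, add_smul, mul_smul]; module
    | succ N =>
      rw [partialD_appellAux l N, mul_smul_comm]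
      rw [one_mul]
      linear_combination (norm := module)
        ((N + 1) * (N + 1 + 2 * l + 1)) • (appellAux_add_two l N).symm

lemma euler_appellAux (l N : ℕ) :
    euler (appellAux l N) + appellAux l N = (N + l) • appellAux l N := by
  induction N using Nat.twoStepInduction with
  | zero => simp [appellAux]
  | one =>
    simp only [appellAux, euler_varZ_pow]
    module
  | more N ih ih' =>
    rw [appellAux_add_two, map_sub, map_add, map_nsmul, map_nsmul, euler_mul, euler_varX,
      euler_X_smul, euler_normSq_smul, eq_sub_of_add_eq ih, eq_sub_of_add_eq ih', mul_sub,
      mul_smul_comm]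
    module

lemma cauchyRiemann_appellAux (l N : ℕ) : cauchyRiemann (appellAux l N) = 0 := by
  induction N using Nat.twoStepInduction with
  | zero => simp [appellAux]
  | one => exact cauchyRiemann_varZ_pow l
  | more N ih ih' =>
    rw [appellAux_add_two, map_sub, map_add, map_nsmul, map_nsmul, cauchyRiemann_X_smul,
      cauchyRiemann_varX_mul, cauchyRiemann_normSq_smul, ih, ih', partialD_appellAux,
      eq_sub_of_add_eq (euler_appellAux l (N + 1)), mul_smul_comm, mul_zero]
    module

lemma laplace_appellAux (l N : ℕ) : laplace (appellAux l N) = 0 := by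
  induction N using Nat.twoStepInduction with
  | zero => simp [appellAux]
  | one => exact laplace_varZ_pow l
  | more N ih ih' =>
    rw [appellAux_add_two, map_sub, map_add, map_nsmul, map_nsmul, laplace_X_smul,
      laplace_varX_mul, laplace_normSq_smul, ih, ih', partialD_appellAux,
      eq_sub_of_add_eq (euler_appellAux l N), cauchyRiemann_appellAux, mul_zero]
    module

lemma angular_appellAux (l N : ℕ) : (2 : MvPolynomial (Fin 3) ℝ) • angular (appellAux l N) =
    unit3 * appellAux l N - (2 * l + 1) • (appellAux l N * unit3) := by
  induction N using Nat.twoStepInduction with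
  | zero => simp [appellAux]
  | one =>
    have hc : unit3 * varZ ^ l = varZ ^ l * unit3 :=
      (show Commute unit3 varZ from unit3_mul_varZ).pow_right l
    simp only [appellAux, angular_varZ_pow, hc]
    module
  | more N ih ih' =>
    rw [appellAux_add_two, map_sub, map_add, map_nsmul, map_nsmul, angular_mul,
      angular_X_smul, angular_normSq_smul]
    have e : (2 : MvPolynomial (Fin 3) ℝ) •
        (angular varX * appellAux l (N + 1) + varX * angular (appellAux l (N + 1))) =
        unit3 * (varX * appellAux l (N + 1)) -
          (2 * l + 1) • (varX * appellAux l (N + 1) * unit3) := by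
      rw [smul_add, ← smul_mul_assoc, ← mul_smul_comm, angular_varX, ih', mul_sub, sub_mul,
        mul_smul_comm]
      simp only [mul_assoc]
      abel
    simp only [smul_add, smul_sub] at e ⊢
    simp only [mul_add, mul_sub, add_mul, sub_mul, mul_smul_comm, smul_mul_assoc]
    linear_combination (norm := module) e +
      (2 * N + 2 * l + 1) • (X 0 : MvPolynomial (Fin 3) ℝ) • ih' -
      (N * (N + 2 * l + 1)) • normSqPoly • ih

@[simp] lemma quat_one_components : (1 : QH).re = 1 ∧ (1 : QH).imI = 0 ∧ (1 : QH).imJ = 0 ∧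
    (1 : QH).imK = 0 := ⟨rfl, rfl, rfl, rfl⟩

@[simp] lemma quat_zero_components : (0 : QH).re = 0 ∧ (0 : QH).imI = 0 ∧ (0 : QH).imJ = 0 ∧
    (0 : QH).imK = 0 := ⟨rfl, rfl, rfl, rfl⟩

@[simp] lemma e1_components : e1.re = 0 ∧ e1.imI = 1 ∧ e1.imJ = 0 ∧ e1.imK = 0 :=
  ⟨rfl, rfl, rfl, rfl⟩

@[simp] lemma e2_components : e2.re = 0 ∧ e2.imI = 0 ∧ e2.imJ = 1 ∧ e2.imK = 0 :=
  ⟨rfl, rfl, rfl, rfl⟩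

@[simp] lemma e3_components : e3.re = 0 ∧ e3.imI = 0 ∧ e3.imJ = 0 ∧ e3.imK = 1 :=
  ⟨rfl, rfl, rfl, rfl⟩

lemma polyQ_star_smul (p : MvPolynomial (Fin 3) ℝ) (f : PolyQ) :
    star (p • f) = p • star f := by
  ext1 <;> simp

/-- Evaluation of a quaternion-valued polynomial. -/
def evalQ (x : R3) : PolyQ →ₗ[ℝ] QH where
  toFun f := ⟨eval x f.re, eval x f.imI, eval x f.imJ, eval x f.imK⟩
  map_add' f g := by ext1 <;> exact map_add _ _ _
  map_smul' c f := by ext1 <;> exact MvPolynomial.smul_eval _ _ _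

section

variable (x : R3) (f g : PolyQ)

@[simp] lemma evalQ_re : (evalQ x f).re = eval x f.re := rfl
@[simp] lemma evalQ_imI : (evalQ x f).imI = eval x f.imI := rfl
@[simp] lemma evalQ_imJ : (evalQ x f).imJ = eval x f.imJ := rfl
@[simp] lemma evalQ_imK : (evalQ x f).imK = eval x f.imK := rfl

lemma evalQ_mul : evalQ x (f * g) = evalQ x f * evalQ x g := by
  ext1 <;> simp

lemma evalQ_star : evalQ x (star f) = star (evalQ x f) := by
  ext1 <;> simp

lemma evalQ_smul (p : MvPolynomial (Fin 3) ℝ) : evalQ x (p • f) = eval x p • evalQ x f := by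
  ext1 <;> simp
end

/-- Integration of quaternion-valued polynomials over the unit ball. -/
def ballIntegralQ : PolyQ →ₗ[ℝ] QH where
  toFun f := ⟨ballIntegral f.re, ballIntegral f.imI, ballIntegral f.imJ, ballIntegral f.imK⟩
  map_add' f g := by ext1 <;> exact map_add _ _ _
  map_smul' c f := by ext1 <;> exact ballIntegral.map_smul _ _

section

variable (f g : PolyQ)

@[simp] lemma ballIntegralQ_re : (ballIntegralQ f).re = ballIntegral f.re := rfl
@[simp] lemma ballIntegralQ_imI : (ballIntegralQ f).imI = ballIntegral f.imI := rfl
@[simp] lemma ballIntegralQ_imJ : (ballIntegralQ f).imJ = ballIntegral f.imJ := rfl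
@[simp] lemma ballIntegralQ_imK : (ballIntegralQ f).imK = ballIntegral f.imK := rfl

lemma ballIntegralQ_unit3_mul : ballIntegralQ (unit3 * f) = e3 * ballIntegralQ f := by
  ext1 <;> simp

lemma ballIntegralQ_mul_unit3 : ballIntegralQ (f * unit3) = ballIntegralQ f * e3 := by
  ext1 <;> simp

lemma ballIntegralQ_partialD (i : Fin 3) :
    ballIntegralQ (partialD i ((1 - normSqPoly) • f)) = 0 := by
  ext1 <;> exact ballIntegral_pderiv i _

lemma setIntegral_evalQ : ∫ x in ball (0 : R3) 1, evalQ x f = ballIntegralQ f := by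
  have h : ∀ x, evalQ x f = eval x f.re • (1 : QH) + eval x f.imI • e1 +
      eval x f.imJ • e2 + eval x f.imK • e3 := fun x => by
    ext1 <;> simp
  have hi := fun (p : MvPolynomial (Fin 3) ℝ) (q : QH) => (integrableOn_eval p).smul_const q
  simp only [h]
  rw [integral_add, integral_add, integral_add]
  any_goals first
    | exact hi _ _
    | exact (hi _ _).add (hi _ _)
    | exact ((hi _ _).add (hi _ _)).add (hi _ _)
  simp only [integral_smul_const]
  ext1 <;> simp <;> rfl
end

/-- Harmonic homogeneous polynomials of different degrees are orthogonal on the ball. -/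
lemma ballIntegralQ_star_mul_of_degree_ne {f g : PolyQ} {n m : ℕ} (hf : laplace f = 0)
    (hg : laplace g = 0) (hfn : euler f = n • f) (hgm : euler g = m • g) (h : n ≠ m) :
    ballIntegralQ (star f * g) = 0 := by
  let V : Fin 3 → PolyQ := fun i => star f * partialD i g - star (partialD i f) * g
  have hV : partialD 0 ((1 - normSqPoly) • V 0) + partialD 1 ((1 - normSqPoly) • V 1) +
      partialD 2 ((1 - normSqPoly) • V 2) =
      2 • (star (euler f) * g - star f * euler g) +
      (1 - normSqPoly) • (star f * laplace g - star (laplace f) * g) := by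
    have hD : ∀ i, partialD i ((1 - normSqPoly) • V i) =
        (1 - normSqPoly) • (star f * partialD i (partialD i g) -
          star (partialD i (partialD i f)) * g) +
        2 • (star ((X i : MvPolynomial (Fin 3) ℝ) • partialD i f) * g -
          star f * ((X i : MvPolynomial (Fin 3) ℝ) • partialD i g)) := fun i => by
      simp only [V, partialD_smul, map_sub, partialD_mul, partialD_star, pderiv_normSqPoly,
        Derivation.map_one_eq_zero, polyQ_star_smul, smul_mul_assoc, mul_smul_comm]
      module
    simp only [hD, euler, laplace, LinearMap.add_apply, LinearMap.smul_apply,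
      LinearMap.comp_apply, star_add, mul_add, add_mul]
    module
  have hI := congrArg ballIntegralQ hV
  have hc : 2 • (star (euler f) * g - star f * euler g) =
      (2 * ((n : ℝ) - m)) • (star f * g) := by
    rw [hfn, hgm, star_nsmul, smul_mul_assoc, mul_smul_comm]
    module
  rw [hc, hf, hg, star_zero, zero_mul, mul_zero, sub_zero, smul_zero, add_zero, map_add, map_add,
    ballIntegralQ_partialD, ballIntegralQ_partialD, ballIntegralQ_partialD, map_smul] at hI
  have hnm : (2 * ((n : ℝ) - m)) ≠ 0 := by
    simpa [sub_eq_zero] using h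
  simpa [hnm] using hI.symm

lemma euler_divergence (W : PolyQ) :
    partialD 0 ((1 - normSqPoly) • (X 0 : MvPolynomial (Fin 3) ℝ) • W) +
      partialD 1 ((1 - normSqPoly) • (X 1 : MvPolynomial (Fin 3) ℝ) • W) +
      partialD 2 ((1 - normSqPoly) • (X 2 : MvPolynomial (Fin 3) ℝ) • W) =
      3 • ((1 - normSqPoly) • W) - 2 • (normSqPoly • W) + (1 - normSqPoly) • euler W := by
  simp only [partialD_smul, map_sub, pderiv_normSqPoly, pderiv_X_self, Derivation.map_one_eq_zero]
  simp only [euler, LinearMap.add_apply, LinearMap.smul_apply, normSqPoly]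
  module

lemma angular_divergence (W : PolyQ) :
    partialD 2 ((1 - normSqPoly) • (X 1 : MvPolynomial (Fin 3) ℝ) • W) -
      partialD 1 ((1 - normSqPoly) • (X 2 : MvPolynomial (Fin 3) ℝ) • W) =
      (1 - normSqPoly) • angular W := by
  simp only [partialD_smul, map_sub, pderiv_normSqPoly, Derivation.map_one_eq_zero,
    pderiv_X_of_ne (show (1 : Fin 3) ≠ 2 by decide),
    pderiv_X_of_ne (show (2 : Fin 3) ≠ 1 by decide)]
  simp only [angular, LinearMap.sub_apply, LinearMap.smul_apply, normSqPoly]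
  module

lemma norm_e3 : ‖e3‖ = 1 := by
  have h : ‖e3‖ * ‖e3‖ = 1 := by
    rw [← Quaternion.normSq_eq_norm_mul_self, Quaternion.normSq_def']
    simp
  nlinarith [norm_nonneg e3]

/-- A homogeneous polynomial on which the rotations about the `x₀`-axis act by left and right
multiplication with different weights integrates to zero over the ball. -/
lemma ballIntegralQ_eq_zero_of_angular {W : PolyQ} {d l k : ℕ} (hd : euler W = d • W)
    (hW : (2 : MvPolynomial (Fin 3) ℝ) • angular W =
      (2 * l + 1) • (unit3 * W) - (2 * k + 1) • (W * unit3)) (h : l ≠ k) :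
    ballIntegralQ W = 0 := by
  have hJ : ballIntegralQ ((1 - normSqPoly) • W) = 0 := by
    have h1 : ballIntegralQ ((1 - normSqPoly) • angular W) = 0 := by
      rw [← angular_divergence, map_sub, ballIntegralQ_partialD, ballIntegralQ_partialD, sub_zero]
    have h2 : 2 • ((1 - normSqPoly) • angular W) =
        (2 * l + 1) • (unit3 * ((1 - normSqPoly) • W)) -
          (2 * k + 1) • ((1 - normSqPoly) • W * unit3) := by
      rw [mul_smul_comm, smul_mul_assoc]
      linear_combination (norm := module) (1 - normSqPoly) • hW
    have h3 := congrArg ballIntegralQ h2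
    rw [map_nsmul, h1, map_sub, map_nsmul, map_nsmul, ballIntegralQ_unit3_mul,
      ballIntegralQ_mul_unit3, smul_zero, eq_comm, sub_eq_zero] at h3
    have h4 := congrArg norm h3
    simp only [← Nat.cast_smul_eq_nsmul ℝ, norm_smul, norm_mul, norm_e3, one_mul, mul_one,
      Real.norm_natCast] at h4
    by_contra hne
    have h5 := mul_right_cancel₀ (norm_ne_zero_iff.mpr hne) h4
    norm_cast at h5
    omega
  have h1 := congrArg ballIntegralQ (euler_divergence W)
  rw [hd, smul_comm (1 - normSqPoly) d W, map_add, map_add, map_add, map_sub, map_nsmul, map_nsmul,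
    map_nsmul, hJ,
    ballIntegralQ_partialD, ballIntegralQ_partialD, ballIntegralQ_partialD] at h1
  have h2 : ballIntegralQ (normSqPoly • W) = 0 := by
    rw [smul_zero, smul_zero, add_zero, zero_sub, add_zero, add_zero, zero_eq_neg,
      ← Nat.cast_smul_eq_nsmul ℝ] at h1
    exact (smul_eq_zero.mp h1).resolve_left (by norm_num)
  have h3 : W = (1 - normSqPoly) • W + normSqPoly • W := by module
  rw [h3, map_add, hJ, h2, add_zero]

/-- Orthogonality of the polynomials `appellAux l (N + 1)`. -/
lemma ballIntegralQ_star_appellAux_mul {l k N M : ℕ} (h : ¬ (l = k ∧ N = M)) :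
    ballIntegralQ (star (appellAux l (N + 1)) * appellAux k (M + 1)) = 0 := by
  have hE : ∀ l N, euler (appellAux l (N + 1)) = (N + l) • appellAux l (N + 1) := fun l N => by
    rw [eq_sub_of_add_eq (euler_appellAux l (N + 1))]
    module
  by_cases hdeg : N + l = M + k
  · refine ballIntegralQ_eq_zero_of_angular (d := N + l + (M + k)) (l := l) (k := k) ?_ ?_
      (by omega)
    · rw [euler_mul, euler_star, hE, hE, star_nsmul, smul_mul_assoc, mul_smul_comm]
      module
    · have hs : star unit3 = -unit3 := by ext1 <;> simp
      rw [angular_mul, angular_star, smul_add, ← smul_mul_assoc, ← mul_smul_comm,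
        ← polyQ_star_smul, angular_appellAux, angular_appellAux, star_sub, star_nsmul, star_mul,
        star_mul, hs, mul_sub, sub_mul, mul_smul_comm, smul_mul_assoc]
      simp only [mul_neg, neg_mul, mul_assoc]
      module
  · exact ballIntegralQ_star_mul_of_degree_ne (laplace_appellAux _ _) (laplace_appellAux _ _)
      (hE l N) (hE k M) hdeg

/-- Three-term recurrence for the coefficients of `(1 - yt)^(-α) (1 - xt)^(-β)`, where the
coefficients `a`, `b` of the two binomial series are given by their recurrences. -/
lemma binomial_product_recurrence {R : Type} [CommRing R] [Algebra ℝ R] (x y : R) (a b : ℕ → ℝ)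
    (α β : ℝ) (ha : ∀ i, (i + 1) * a (i + 1) = (α + i) * a i)
    (hb : ∀ i, (i + 1) * b (i + 1) = (β + i) * b i) (P : ℕ → R)
    (hP : ∀ N, P N = ∑ p ∈ antidiagonal N, (a p.1 * b p.2) • (y ^ p.1 * x ^ p.2)) :
    P 1 = (α • y + β • x) * P 0 ∧ ∀ N : ℕ, ((N : ℝ) + 2) • P (N + 2) =
      (((N : ℝ) + 1) • (x + y) + α • y + β • x) * P (N + 1) -
        ((N : ℝ) + α + β) • (x * y * P N) := by
  let A : PowerSeries R := PowerSeries.mk fun i => a i • y ^ i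
  let B : PowerSeries R := PowerSeries.mk fun i => b i • x ^ i
  have key : ∀ (c : ℕ → ℝ) (γ : ℝ) (z : R), (∀ i, (i + 1) * c (i + 1) = (γ + i) * c i) →
      (1 - PowerSeries.C z * PowerSeries.X) *
        PowerSeries.derivative R (PowerSeries.mk fun i => c i • z ^ i) =
      PowerSeries.C (γ • z) * PowerSeries.mk fun i => c i • z ^ i := by
    intro c γ z hc
    ext i
    rw [sub_mul, one_mul, mul_assoc, map_sub, PowerSeries.coeff_C_mul, PowerSeries.coeff_C_mul,
      PowerSeries.coeff_derivative]
    cases i with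
    | zero =>
      have h0 := congrArg (algebraMap ℝ R) (hc 0)
      simp only [PowerSeries.coeff_zero_X_mul, PowerSeries.coeff_mk, Algebra.smul_def, map_mul,
        map_add, map_natCast, map_one] at h0 ⊢
      push_cast at h0 ⊢
      linear_combination z * h0
    | succ i =>
      have h0 := congrArg (algebraMap ℝ R) (hc (i + 1))
      simp only [PowerSeries.coeff_succ_X_mul, PowerSeries.coeff_derivative, PowerSeries.coeff_mk,
        Algebra.smul_def, map_mul, map_add, map_natCast, map_one] at h0 ⊢
      push_cast at h0 ⊢
      linear_combination z ^ (i + 2) * h0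
  have hA : (1 - PowerSeries.C y * PowerSeries.X) * PowerSeries.derivative R A =
      PowerSeries.C (α • y) * A := key a α y ha
  have hB : (1 - PowerSeries.C x * PowerSeries.X) * PowerSeries.derivative R B =
      PowerSeries.C (β • x) * B := key b β x hb
  have hF : (1 - PowerSeries.C (x + y) * PowerSeries.X +
      PowerSeries.C (x * y) * PowerSeries.X ^ 2) * PowerSeries.derivative R (A * B) =
      (PowerSeries.C (α • y + β • x) - PowerSeries.C ((α + β) • (x * y)) * PowerSeries.X) *
        (A * B) := by
    rw [Derivation.leibniz]
    simp only [smul_eq_mul, map_add, map_mul, Algebra.smul_def] at hA hB ⊢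
    linear_combination A * (1 - PowerSeries.C y * PowerSeries.X) * hB +
      B * (1 - PowerSeries.C x * PowerSeries.X) * hA
  have hc : ∀ N, PowerSeries.coeff N (A * B) = P N := by
    intro N
    rw [PowerSeries.coeff_mul, hP]
    simp only [A, B, PowerSeries.coeff_mk]
    refine sum_congr rfl fun p _ => ?_
    rw [smul_mul_smul_comm]
  have hco := fun N => congrArg (PowerSeries.coeff N) hF
  simp only [add_mul, sub_mul, one_mul, mul_assoc, map_add, map_sub, PowerSeries.coeff_C_mul,
    PowerSeries.coeff_derivative, hc] at hco
  simp only [pow_two, mul_assoc] at hco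
  refine ⟨?_, fun N => ?_⟩
  · have h0 := hco 0
    simp only [PowerSeries.coeff_zero_X_mul, Algebra.smul_def, map_add] at h0 ⊢
    push_cast at h0
    linear_combination h0
  · have h0 := hco (N + 1)
    cases N with
    | zero =>
      simp only [PowerSeries.coeff_succ_X_mul, PowerSeries.coeff_zero_X_mul, hc,
        PowerSeries.coeff_derivative, Algebra.smul_def,
        map_add, map_natCast, map_one, map_ofNat] at h0 ⊢
      push_cast at h0 ⊢
      linear_combination h0
    | succ N =>
      simp only [PowerSeries.coeff_succ_X_mul, hc, PowerSeries.coeff_derivative, Algebra.smul_def,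
        map_add, map_natCast, map_one, map_ofNat] at h0 ⊢
      push_cast at h0 ⊢
      linear_combination h0

@[simp] lemma toQ_components (x : R3) : (toQ x).re = x 0 ∧ (toQ x).imI = x 1 ∧
    (toQ x).imJ = x 2 ∧ (toQ x).imK = 0 := ⟨rfl, rfl, rfl, rfl⟩

@[simp] lemma toQbar_components (x : R3) : (toQbar x).re = x 0 ∧ (toQbar x).imI = -x 1 ∧
    (toQbar x).imJ = -x 2 ∧ (toQbar x).imK = 0 := ⟨rfl, rfl, rfl, rfl⟩

@[simp] lemma zeta_components (x : R3) : (zeta x).re = x 1 ∧ (zeta x).imI = 0 ∧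
    (zeta x).imJ = 0 ∧ (zeta x).imK = -x 2 := ⟨rfl, rfl, rfl, rfl⟩

/-- Coefficient of `x̄ⁱ` in the Appell polynomials. -/
def appellCoeffBar (l i : ℕ) : ℝ :=
  (2 * l + 2 * i).factorial / (4 ^ i * i.factorial * (l + i).factorial)

/-- Coefficient of `xʲ` in the Appell polynomials. -/
def appellCoeff (l j : ℕ) : ℝ :=
  (2 * l + 2 * j + 1).factorial / (4 ^ j * j.factorial * (l + j).factorial)

lemma appellCoeffBar_succ (l i : ℕ) :
    (i + 1) * appellCoeffBar l (i + 1) = ((l + 1 / 2 : ℝ) + i) * appellCoeffBar l i := by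
  have h1 : (2 * l + 2 * (i + 1)).factorial =
      (2 * l + 2 * i + 2) * ((2 * l + 2 * i + 1) * (2 * l + 2 * i).factorial) := rfl
  have h2 : (l + (i + 1)).factorial = (l + i + 1) * (l + i).factorial := rfl
  have h3 : (l + i + 1 : ℝ) ≠ 0 := by positivity
  simp only [appellCoeffBar, h1, h2, Nat.factorial_succ i]
  push_cast
  field_simp
  ring

lemma appellCoeff_succ (l j : ℕ) :
    (j + 1) * appellCoeff l (j + 1) = ((l + 3 / 2 : ℝ) + j) * appellCoeff l j := by
  have h1 : (2 * l + 2 * (j + 1) + 1).factorial =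
      (2 * l + 2 * j + 3) * ((2 * l + 2 * j + 2) * (2 * l + 2 * j + 1).factorial) := rfl
  have h2 : (l + (j + 1)).factorial = (l + j + 1) * (l + j).factorial := rfl
  have h3 : (l + j + 1 : ℝ) ≠ 0 := by positivity
  simp only [appellCoeff, h1, h2, Nat.factorial_succ j]
  push_cast
  field_simp
  ring

/-- The quaternionic factor `∑ᵢ aᵢ bⱼ x̄ⁱ xʲ`, `i + j = N`, of the Appell polynomial. -/
def appellSum (l N : ℕ) (x : R3) : QH :=
  ∑ p ∈ antidiagonal N, (appellCoeffBar l p.1 * appellCoeff l p.2) •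
    (toQbar x ^ p.1 * toQ x ^ p.2)

lemma appellSum_recurrence (l : ℕ) (x : R3) :
    appellSum l 1 x = ((2 * l + 1 : ℝ) • (x 0 • 1) + toQ x) * appellSum l 0 x ∧
    ∀ N : ℕ, ((N : ℝ) + 2) • appellSum l (N + 2) x =
      ((2 * (N + 1) + 2 * l + 1 : ℝ) • (x 0 • 1) + toQ x) * appellSum l (N + 1) x -
        ((N : ℝ) + 2 * l + 2) • (eval x normSqPoly • appellSum l N x) := by
  let φ : Polynomial ℝ →ₐ[ℝ] QH := Polynomial.aeval (toQ x)
  let y : Polynomial ℝ := Polynomial.C (2 * x 0) - Polynomial.X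
  have hX : φ Polynomial.X = toQ x := Polynomial.aeval_X _
  have hy : φ y = toQbar x := by
    simp only [φ, y, map_sub, Polynomial.aeval_X, Polynomial.aeval_C,
      Algebra.algebraMap_eq_smul_one]
    ext1 <;> simp <;> ring
  have hφ : ∀ N, φ (∑ p ∈ antidiagonal N, (appellCoeffBar l p.1 * appellCoeff l p.2) •
      (y ^ p.1 * Polynomial.X ^ p.2)) = appellSum l N x := fun N => by
    simp only [map_sum, map_smul, map_mul, map_pow, hX, hy, appellSum]
  obtain ⟨h1, h2⟩ := binomial_product_recurrence Polynomial.X y (appellCoeffBar l) (appellCoeff l)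
    (l + 1 / 2) (l + 3 / 2) (appellCoeffBar_succ l) (appellCoeff_succ l) _ fun _ => rfl
  have hs : toQ x * toQbar x = eval x normSqPoly • 1 := by
    ext1 <;> simp [normSqPoly] <;> ring
  constructor
  · have := congrArg φ h1
    simp only [map_mul, map_add, map_smul, hφ, hX, hy] at this
    rw [this]
    congr 1
    ext1 <;> simp <;> ring
  · intro N
    have := congrArg φ (h2 N)
    simp only [map_mul, map_add, map_sub, map_smul, hφ, hX, hy, hs, smul_mul_assoc, one_mul] at this
    rw [this]
    congr 1
    · congr 1
      ext1 <;> simp <;> ring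
    · congr 1
      ring

lemma evalQ_varX (x : R3) : evalQ x varX = toQ x := by
  ext1 <;> simp

lemma evalQ_varZ_pow (x : R3) (l : ℕ) : evalQ x (varZ ^ l) = zeta x ^ l := by
  induction l with
  | zero => ext1 <;> simp
  | succ l ih =>
    have h : evalQ x varZ = zeta x := by ext1 <;> simp
    rw [pow_succ, evalQ_mul, ih, h, pow_succ]

lemma appellSum_zero (l : ℕ) (x : R3) :
    appellSum l 0 x = (appellCoeffBar l 0 * appellCoeff l 0) • 1 := by
  simp [appellSum]

lemma evalQ_appellAux_add_two (l N : ℕ) (x : R3) : evalQ x (appellAux l (N + 2)) =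
    ((2 * N + 2 * l + 1 : ℝ) • (x 0 • 1) + toQ x) * evalQ x (appellAux l (N + 1)) -
      (N * (N + 2 * l + 1) : ℝ) • (eval x normSqPoly • evalQ x (appellAux l N)) := by
  rw [appellAux_add_two, map_sub, map_add, map_nsmul, map_nsmul, evalQ_mul, evalQ_smul, evalQ_smul,
    evalQ_varX, eval_X, add_mul, smul_mul_assoc, smul_mul_assoc, one_mul]
  module

lemma evalQ_appellAux (l : ℕ) (x : R3) (N : ℕ) :
    (appellCoeffBar l 0 * appellCoeff l 0) • evalQ x (appellAux l (N + 1)) =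
      (N.factorial : ℝ) • (appellSum l N x * zeta x ^ l) := by
  obtain ⟨h1, h2⟩ := appellSum_recurrence l x
  have hT : evalQ x (appellAux l 1) = zeta x ^ l := evalQ_varZ_pow x l
  induction N using Nat.twoStepInduction with
  | zero =>
    rw [hT, appellSum_zero, Nat.factorial_zero, Nat.cast_one, one_smul, smul_mul_assoc, one_mul]
  | one =>
    rw [evalQ_appellAux_add_two, hT, h1, appellSum_zero, Nat.factorial_one, Nat.cast_one, one_smul,
      mul_smul_comm, smul_mul_assoc, mul_one, Nat.cast_zero, mul_zero, zero_add, zero_mul,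
      zero_smul, sub_zero]
  | more N ih ih' =>
    generalize appellCoeffBar l 0 * appellCoeff l 0 = c at ih ih' ⊢
    have hf : ((N + 2).factorial : ℝ) = (N + 1).factorial * (N + 2) := by
      rw [Nat.factorial_succ (N + 1)]
      push_cast
      ring
    have hf' : ((N + 1).factorial : ℝ) = N.factorial * (N + 1) := by
      rw [Nat.factorial_succ N]
      push_cast
      ring
    rw [hf, mul_smul, ← smul_mul_assoc, h2, sub_mul, mul_assoc, smul_sub, ← mul_smul_comm, ← ih',
      hf', evalQ_appellAux_add_two, smul_sub, mul_smul_comm, smul_mul_assoc, smul_mul_assoc]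
    push_cast
    congr 1
    linear_combination (norm := module) ((N + 1) * (N + 2 * l + 2) : ℝ) • eval x normSqPoly • ih

/-- The Appell polynomials are real multiples of the polynomials `appellAux`. -/
lemma exists_appell_eq_smul (l N : ℕ) :
    ∃ c : ℝ, ∀ x, appell (N + l) l x = c • evalQ x (appellAux l (N + 1)) := by
  have hs : ∀ x, ∑ h ∈ Finset.range (N + l - l + 1),
      (((2 * (N + l) - 2 * h + 1).factorial * (2 * l + 2 * h).factorial : ℝ) /
        (h.factorial * (N + l - l - h).factorial * (N + l - h).factorial * (l + h).factorial)) •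
          (toQbar x ^ h * toQ x ^ (N + l - l - h)) = (4 ^ N : ℝ) • appellSum l N x := fun x => by
    rw [appellSum, Finset.Nat.sum_antidiagonal_eq_sum_range_succ_mk, smul_sum, Nat.add_sub_cancel]
    refine sum_congr rfl fun h hh => ?_
    obtain ⟨j, rfl⟩ := Nat.exists_eq_add_of_le (Nat.lt_succ_iff.mp (mem_range.mp hh))
    have hexp : 2 * (h + j + l) - 2 * h + 1 = 2 * l + 2 * j + 1 := by omega
    have hsub : h + j + l - h = l + j := by omega
    rw [Nat.add_sub_cancel_left, hexp, hsub, smul_smul]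
    congr 1
    simp only [appellCoeff, appellCoeffBar]
    field_simp
    rw [pow_add]
  refine ⟨((N + l).factorial * l.factorial : ℝ) /
      (2 ^ (2 * (N + l - l)) * (N + l + l + 1).factorial * (2 * l).factorial) * 4 ^ N *
      (N.factorial : ℝ)⁻¹ * (appellCoeffBar l 0 * appellCoeff l 0), fun x => ?_⟩
  have hN : (N.factorial : ℝ) ≠ 0 := by positivity
  rw [appell, hs, mul_smul _ (appellCoeffBar l 0 * appellCoeff l 0), evalQ_appellAux, smul_smul,
    inv_mul_cancel_right₀ hN, mul_smul, smul_mul_assoc]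

end PolynomialCalculus

/-- orthogonality of the Appell polynomials over the unit ball. -/
theorem appell_orthogonal_ball (n l m k : ℕ) (hl : l ≤ n) (hk : k ≤ m)
    (hne : (n, l) ≠ (m, k)) :
    ∫ x in ball (0 : R3) 1, star (appell n l x) * appell m k x = 0 := by
  obtain ⟨N, rfl⟩ := Nat.exists_eq_add_of_le' hl
  obtain ⟨M, rfl⟩ := Nat.exists_eq_add_of_le' hk
  obtain ⟨c, hc⟩ := exists_appell_eq_smul l N
  obtain ⟨d, hd⟩ := exists_appell_eq_smul k M
  have h : ∀ x, star (appell (N + l) l x) * appell (M + k) k x =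
      (c * d) • evalQ x (star (appellAux l (N + 1)) * appellAux k (M + 1)) := fun x => by
    rw [hc, hd, evalQ_mul, evalQ_star, Quaternion.star_smul, smul_mul_smul_comm]
  simp only [h]
  rw [integral_smul, setIntegral_evalQ, ballIntegralQ_star_appellAux_mul, smul_zero]
  rintro ⟨rfl, rfl⟩
  exact hne rfl
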